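/- arXiv:1001.2774 — 3 statements merged into one kernel-verified Lean document; each statement's English description precedes it below -/
import Mathlib

section
/- Let r ≥ 1 and let d, d_0 be integers with d_0 ≥ r. Suppose p_0, p_1, …, p_g is an admissible lingering lattice path in ℤ^r with p_0 = (d_0, d_0−1, …, d_0−r+1), lying entirely in the open Weyl chamber C, and having exactly g − d + d_0 steps equal to (−1,−1,…,−1). Then the number of lingering steps of the path is at most ρ = g − (r+1)(g−d+r). (This gives the upper bound dim W^r_d(Γ) ≤ ρ in the tropical Brill–Noether dimension theorem.) -/
open scoped Classical

/-- The `i`-th step of the path `p` is the vector `(−1, …, −1)`. -/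
def negStep (r : ℕ) (p : ℕ → Fin r → ℤ) (i : ℕ) : Prop :=
  ∀ k, p i k = p (i - 1) k - 1

/-- The `i`-th step of the path `p` is the standard basis vector `e j`. -/
def eStep (r : ℕ) (p : ℕ → Fin r → ℤ) (i : ℕ) (j : Fin r) : Prop :=
  ∀ k, p i k = p (i - 1) k + if k = j then 1 else 0

/-- The `i`-th step of the path `p` is zero (a lingering step). -/
def lingerStep (r : ℕ) (p : ℕ → Fin r → ℤ) (i : ℕ) : Prop :=
  ∀ k, p i k = p (i - 1) k

/-- `p 0, p 1, …, p g` is a lingering lattice path in `ℤ^r`: each successive difference is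
`(−1, …, −1)`, a standard basis vector, or zero. -/
def IsLLP (r g : ℕ) (p : ℕ → Fin r → ℤ) : Prop :=
  ∀ i ∈ Finset.Icc 1 g, negStep r p i ∨ (∃ j, eStep r p i j) ∨ lingerStep r p i

/-- The open Weyl chamber `C = {y : y 0 > y 1 > ⋯ > y (r−1) > 0}`. -/
def inC (r : ℕ) (y : Fin r → ℤ) : Prop :=
  (∀ j k : Fin r, j < k → y k < y j) ∧ ∀ k, 0 < y k

/-- The path is admissible: every step in a coordinate direction `e j` occurs only when
both `p (i−1)` and `p (i−1) + e j` lie in the open Weyl chamber. -/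
def Admissible (r g : ℕ) (p : ℕ → Fin r → ℤ) : Prop :=
  ∀ i ∈ Finset.Icc 1 g, ∀ j, eStep r p i j → inC r (p (i - 1)) ∧ inC r (p i)

/-- The `j`-th coordinate of a point of the open Weyl chamber is at least `r − j`. -/
theorem inC.sub_le {r : ℕ} {y : Fin r → ℤ} (hy : inC r y) (j : Fin r) :
    (r : ℤ) - (j : ℤ) ≤ y j := by
  have key : ∀ n : ℕ, ∀ k : Fin r, (k : ℕ) + n + 1 = r → (n : ℤ) + 1 ≤ y k := by
    intro n
    induction n with
    | zero =>
      intro k _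
      have := hy.2 k
      push_cast
      omega
    | succ n ih =>
      intro k hk
      have hlt : (k : ℕ) + 1 < r := by omega
      have h₁ := ih ⟨k + 1, hlt⟩ (by simp only; omega)
      have h₂ := hy.1 k ⟨k + 1, hlt⟩ (by simp [Fin.lt_def])
      push_cast
      omega
  have hj := j.isLt
  have := key (r - 1 - j) j (by omega)
  omega

/-- The change of the coordinate sum along one step, weighted by the type of the step. -/
theorem sum_step_eq {r : ℕ} (hr : 1 ≤ r) {p : ℕ → Fin r → ℤ} {i : ℕ}
    (h : negStep r p i ∨ (∃ j, eStep r p i j) ∨ lingerStep r p i) :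
    ∑ k, p i k + ((r : ℤ) + 1) * (if negStep r p i then 1 else 0)
      + (if lingerStep r p i then 1 else 0) = ∑ k, p (i - 1) k + 1 := by
  rcases h with h | ⟨j, h⟩ | h
  · have hl : ¬ lingerStep r p i := fun hl => by
      have h₁ := h ⟨0, hr⟩
      have h₂ := hl ⟨0, hr⟩
      omega
    rw [if_pos h, if_neg hl, Finset.sum_congr rfl fun k _ => h k]
    simp only [Finset.sum_sub_distrib, Finset.sum_const, Finset.card_univ, Fintype.card_fin,
      nsmul_eq_mul]
    ring
  · have hj := h j
    rw [if_pos rfl] at hj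
    have hl : ¬ lingerStep r p i := fun hl => by
      have := hl j
      omega
    have hn : ¬ negStep r p i := fun hn => by
      have := hn j
      omega
    rw [if_neg hn, if_neg hl, Finset.sum_congr rfl fun k _ => h k, Finset.sum_add_distrib]
    simp
  · have hn : ¬ negStep r p i := fun hn => by
      have h₁ := h ⟨0, hr⟩
      have h₂ := hn ⟨0, hr⟩
      omega
    rw [if_neg hn, if_pos h, Finset.sum_congr rfl fun k _ => h k]
    ring

/-- The coordinate sum of the endpoint in terms of the numbers of steps of each type. -/
theorem IsLLP.sum_eq {r g : ℕ} (hr : 1 ≤ r) {p : ℕ → Fin r → ℤ} (hpath : IsLLP r g p) :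
    ∑ k, p g k + ((r : ℤ) + 1) * ((Finset.Icc 1 g).filter (fun i => negStep r p i)).card
      + ((Finset.Icc 1 g).filter (fun i => lingerStep r p i)).card = ∑ k, p 0 k + g := by
  induction g with
  | zero => simp
  | succ g ih =>
    have ih := ih fun i hi => hpath i (Finset.Icc_subset_Icc_right g.le_succ hi)
    have hs := sum_step_eq hr (hpath (g + 1) (by simp))
    simp only [Finset.natCast_card_filter] at ih ⊢
    rw [Finset.sum_Icc_succ_top (by omega), Finset.sum_Icc_succ_top (by omega)]
    rw [Nat.add_sub_cancel] at hs
    push_cast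
    linarith

/-- Let `r ≥ 1`, `d, d₀` integers with `d₀ ≥ r`, and let `p 0, …, p g` be an admissible
lingering lattice path in `ℤ^r` starting at `(d₀, d₀−1, …, d₀−r+1)`, lying entirely in the
open Weyl chamber, with exactly `g − d + d₀` steps equal to `(−1, …, −1)`.  Then the number
of lingering steps is at most `ρ = g − (r+1)(g−d+r)`. -/
theorem lingering_steps_at_most_rho
    (r : ℕ) (hr : 1 ≤ r) (d d₀ : ℤ) (hd₀ : (r : ℤ) ≤ d₀) (g : ℕ)
    (p : ℕ → Fin r → ℤ) (hpath : IsLLP r g p) (hadm : Admissible r g p)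
    (hstart : ∀ j : Fin r, p 0 j = d₀ - (j : ℤ))
    (hC : ∀ i ≤ g, inC r (p i))
    (hneg : (((Finset.Icc 1 g).filter (fun i => negStep r p i)).card : ℤ) = (g : ℤ) - d + d₀) :
    (((Finset.Icc 1 g).filter (fun i => lingerStep r p i)).card : ℤ) ≤
      (g : ℤ) - ((r : ℤ) + 1) * ((g : ℤ) - d + (r : ℤ)) := by
  have hsum := hpath.sum_eq hr
  have hend : ∑ k : Fin r, ((r : ℤ) - (k : ℤ)) ≤ ∑ k, p g k :=
    Finset.sum_le_sum fun k _ => (hC g le_rfl).sub_le k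
  rw [Finset.sum_congr rfl fun k _ => hstart k, hneg] at hsum
  simp only [Finset.sum_sub_distrib, Finset.sum_const, Finset.card_univ, Fintype.card_fin,
    nsmul_eq_mul] at hsum hend
  linarith
end

section
/- Let r ≥ 1 and m ≥ 1 be integers and set g = (r+1)m. The number of lattice paths p_0, p_1, …, p_g in ℤ^r with p_0 = p_g = (r, r−1, …, 1), with every step p_i − p_{i−1} belonging to {e_0, …, e_{r−1}, (−1,−1,…,−1)}, and with every p_i in the open Weyl chamber C, is exactly λ = g! · ∏_{i=0}^{r} i!/(m+i)!. (When ρ = 0 and m = g−d+r, this λ is the number of divisor classes of degree d and rank r on a generic chain of g loops, matching the classical Brill–Noether count.) -/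
open scoped Classical

/-- Extend a finite path `p : Fin (g+1) → Fin r → ℤ` to a function on `ℕ` (constant after `g`). -/
def ext (g r : ℕ) (p : Fin (g + 1) → Fin r → ℤ) : ℕ → Fin r → ℤ :=
  fun i => p ⟨min i g, by omega⟩

/-- A lattice path `p 0, …, p g` with `p 0 = p g = (r, r−1, …, 1)`, every step a standard
basis vector or `(−1, …, −1)` (no lingering steps), and every point in the open Weyl
chamber. -/
def IsGoodPath (r g : ℕ) (p : ℕ → Fin r → ℤ) : Prop :=
  (∀ j : Fin r, p 0 j = (r : ℤ) - (j : ℤ)) ∧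
  (∀ j : Fin r, p g j = (r : ℤ) - (j : ℤ)) ∧
  (∀ i ∈ Finset.Icc 1 g, negStep r p i ∨ ∃ j, eStep r p i j) ∧
  (∀ i ≤ g, inC r (p i))

section

open Finset Matrix

/-- The reciprocal factorial, extended by zero to the negative integers. -/
noncomputable def invFactorial (k : ℤ) : ℚ :=
  if 0 ≤ k then (k.toNat.factorial : ℚ)⁻¹ else 0

lemma invFactorial_natCast (n : ℕ) : invFactorial n = (n.factorial : ℚ)⁻¹ := by
  simp [invFactorial]

lemma invFactorial_of_neg {k : ℤ} (hk : k < 0) : invFactorial k = 0 := by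
  simp [invFactorial, hk]

lemma invFactorial_sub_one (k : ℤ) : invFactorial (k - 1) = k * invFactorial k := by
  rcases lt_trichotomy k 0 with hk | rfl | hk
  · rw [invFactorial_of_neg hk, invFactorial_of_neg (by omega), mul_zero]
  · rw [invFactorial_of_neg (by omega)]; simp
  · obtain ⟨n, rfl⟩ : ∃ n : ℕ, k = (n : ℤ) + 1 := ⟨(k - 1).toNat, by omega⟩
    have h := invFactorial_natCast (n + 1)
    push_cast at h
    rw [h, add_sub_cancel_right, invFactorial_natCast, Nat.factorial_succ]
    push_cast
    have h1 : (n.factorial : ℚ) ≠ 0 := by exact_mod_cast n.factorial_ne_zero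
    field_simp

/-- The determinant `det (1 / (h i + j)!)`, which for `h i = a i - i` is the number of standard
Young tableaux of shape `a` divided by `(∑ i, a i)!`. -/
noncomputable def tableauDet {n : ℕ} (h : Fin n → ℤ) : ℚ :=
  det (of fun j i : Fin n => invFactorial (h i + (j : ℕ)))

lemma tableauDet_eq_sum {n : ℕ} (h : Fin n → ℤ) :
    tableauDet h = ∑ σ : Equiv.Perm (Fin n),
      ((Equiv.Perm.sign σ : ℤ) : ℚ) * ∏ i, invFactorial (h i + (σ i : ℕ)) := by
  simp [tableauDet, det_apply']

lemma tableauDet_eq_zero_of_not_injective {n : ℕ} {h : Fin n → ℤ}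
    (hh : ¬ Function.Injective h) : tableauDet h = 0 := by
  simp only [Function.Injective, not_forall] at hh
  obtain ⟨a, b, hab, hne⟩ := hh
  exact det_zero_of_column_eq hne fun k => by simp [hab]

/-- Removing one box from a shape in all possible ways. -/
lemma sum_tableauDet_sub_single {n : ℕ} (h : Fin n → ℤ) :
    ∑ k, tableauDet (h - Pi.single k 1) =
      ((∑ k, (h k + (k : ℕ)) : ℤ) : ℚ) * tableauDet h := by
  simp only [tableauDet_eq_sum]
  rw [sum_comm, mul_sum]
  refine sum_congr rfl fun σ _ => ?_
  have key : ∀ k, ∏ i, invFactorial ((h - Pi.single k 1 : Fin n → ℤ) i + (σ i : ℕ)) =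
      ((h k + (σ k : ℕ) : ℤ) : ℚ) * ∏ i, invFactorial (h i + (σ i : ℕ)) := by
    intro k
    rw [← mul_prod_erase univ _ (mem_univ k), ← mul_prod_erase univ
      (fun i => invFactorial (h i + (σ i : ℕ))) (mem_univ k), ← mul_assoc,
      ← invFactorial_sub_one]
    congr 1
    · simp only [Pi.sub_apply, Pi.single_eq_same]
      congr 1
      ring
    · refine prod_congr rfl fun i hi => ?_
      simp [Pi.single_eq_of_ne (ne_of_mem_erase hi)]
  have hσ : ∑ k, (h k + (σ k : ℕ)) = ∑ k, (h k + (k : ℕ)) := by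
    rw [sum_add_distrib, sum_add_distrib, Equiv.sum_comp σ fun k => ((k : ℕ) : ℤ)]
  simp only [key]
  rw [← mul_sum, ← sum_mul, ← Int.cast_sum, hσ]
  ring

lemma tableauDet_neg_id (n : ℕ) : tableauDet (fun i : Fin n => -((i : ℕ) : ℤ)) = 1 := by
  rw [tableauDet, det_of_isLowerTriangular]
  · simp [invFactorial]
  · intro i j hij
    have : (i : ℕ) < j := hij
    exact invFactorial_of_neg (by omega)

lemma tableauDet_rectangle (r m : ℕ) :
    tableauDet (fun i : Fin (r + 1) => (m : ℤ) - (i : ℕ)) =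
      ∏ i ∈ range (r + 1), ((i.factorial : ℚ) / ((m + i).factorial : ℚ)) := by
  have entry : ∀ i j : ℕ, invFactorial ((m : ℤ) - i + j) =
      ((m + j).factorial : ℚ)⁻¹ * (descPochhammer ℚ i).eval ((j : ℚ) + m) := by
    intro i j
    have h1 : ((m + j).factorial : ℚ) ≠ 0 := by exact_mod_cast (m + j).factorial_ne_zero
    rw [show ((j : ℚ) + m) = ((m + j : ℕ) : ℚ) by push_cast; ring,
      descPochhammer_eval_eq_descFactorial]
    rcases le_or_gt i (m + j) with hij | hij
    · rw [show ((m : ℤ) - i + j) = ((m + j - i : ℕ) : ℤ) by omega, invFactorial_natCast,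
        ← Nat.factorial_mul_descFactorial hij]
      have h2 : ((m + j - i).factorial : ℚ) ≠ 0 := by
        exact_mod_cast (m + j - i).factorial_ne_zero
      have h3 : ((m + j).descFactorial i : ℚ) ≠ 0 := by
        simpa [Nat.descFactorial_eq_zero_iff_lt] using hij
      push_cast
      field_simp
    · rw [invFactorial_of_neg (by omega), Nat.descFactorial_of_lt hij]
      simp
  have hV := det_eval_matrixOfPolynomials_eq_det_vandermonde
    (fun j : Fin (r + 1) => ((j : ℕ) : ℚ) + m) (fun i => descPochhammer ℚ i)
    (fun i => descPochhammer_natDegree ℚ i) (fun i => monic_descPochhammer ℚ i)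
  rw [det_vandermonde_add, det_vandermonde_id_eq_superFactorial] at hV
  have hM : (of fun j i : Fin (r + 1) => invFactorial ((m : ℤ) - (i : ℕ) + (j : ℕ))) =
      of fun j i : Fin (r + 1) => ((m + j).factorial : ℚ)⁻¹ *
        (of fun j i : Fin (r + 1) => (descPochhammer ℚ i).eval (((j : ℕ) : ℚ) + m)) j i := by
    ext j i
    exact entry i j
  rw [tableauDet, hM, det_mul_column, ← hV, prod_div_distrib, ← Nat.cast_prod,
    Nat.prod_range_succ_factorial, Fin.prod_univ_eq_prod_range
      (fun j => ((m + j).factorial : ℚ)⁻¹) (r + 1), prod_inv_distrib]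
  ring

/-- The projection `ℤ^(r+1) → ℤ^r` with kernel spanned by `(1, …, 1)`. It sends the standard basis
to `e_0, …, e_{r-1}, (-1, …, -1)`. -/
def chamberProj {r : ℕ} (h : Fin (r + 1) → ℤ) : Fin r → ℤ :=
  fun k => h k.castSucc - h (Fin.last r)

lemma chamberProj_sub {r : ℕ} (h h' : Fin (r + 1) → ℤ) :
    chamberProj (h - h') = chamberProj h - chamberProj h' := by
  ext k
  simp only [chamberProj, Pi.sub_apply]
  ring

lemma inC_chamberProj_iff {r : ℕ} (h : Fin (r + 1) → ℤ) :
    inC r (chamberProj h) ↔ StrictAnti h := by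
  constructor
  · rintro ⟨h1, h2⟩ a b hab
    induction b using Fin.lastCases with
    | last =>
      obtain ⟨a, rfl⟩ := Fin.exists_castSucc_eq.2 hab.ne
      have := h2 a
      simp only [chamberProj] at this
      omega
    | cast b =>
      obtain ⟨a, rfl⟩ := Fin.exists_castSucc_eq.2 (hab.trans (Fin.castSucc_lt_last b)).ne
      have := h1 a b (by simpa using hab)
      simp only [chamberProj] at this
      omega
  · intro hh
    refine ⟨fun j k hjk => ?_, fun k => ?_⟩
    · have := hh (Fin.castSucc_lt_castSucc_iff.2 hjk)
      simp only [chamberProj]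
      omega
    · have := hh (Fin.castSucc_lt_last k)
      simp only [chamberProj]
      omega

/-- The step vectors `e_0, …, e_{r-1}, (-1, …, -1)`. -/
def stepVec {r : ℕ} (i : Fin (r + 1)) : Fin r → ℤ :=
  chamberProj (Pi.single i 1)

lemma stepVec_castSucc {r : ℕ} (j k : Fin r) :
    stepVec j.castSucc k = if k = j then 1 else 0 := by
  simp [stepVec, chamberProj, Pi.single_apply, (Fin.castSucc_lt_last j).ne']

lemma stepVec_last {r : ℕ} (k : Fin r) : stepVec (Fin.last r) k = -1 := by
  simp [stepVec, chamberProj, (Fin.castSucc_lt_last k).ne]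

lemma stepVec_injective {r : ℕ} : Function.Injective (stepVec : Fin (r + 1) → Fin r → ℤ) := by
  intro a b hab
  induction a using Fin.lastCases with
  | last =>
    induction b using Fin.lastCases with
    | last => rfl
    | cast b =>
      have := congrFun hab b
      simp [stepVec_last, stepVec_castSucc] at this
  | cast a =>
    have := congrFun hab a
    induction b using Fin.lastCases with
    | last => simp [stepVec_last, stepVec_castSucc] at this
    | cast b =>
      simp only [stepVec_castSucc] at this
      by_cases hne : a = b
      · rw [hne]
      · simp [hne] at this

/-- The point `(r, r-1, …, 1)`. -/
def startPoint (r : ℕ) : Fin r → ℤ := fun j => (r : ℤ) - (j : ℕ)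

/-- The paths of length `n` from `(r, r-1, …, 1)` to `y` inside the open Weyl chamber. -/
noncomputable def chamberPaths (r : ℕ) : (n : ℕ) → (Fin r → ℤ) → Finset (Fin (n + 1) → Fin r → ℤ)
  | 0, y => if y = startPoint r ∧ inC r y then {fun _ => y} else ∅
  | n + 1, y => if inC r y then
      univ.biUnion fun i => (chamberPaths r n (y - stepVec i)).image
        fun p => Fin.snoc (α := fun _ => Fin r → ℤ) p y
    else ∅

lemma mem_chamberPaths {r n : ℕ} {y : Fin r → ℤ} {p : Fin (n + 1) → Fin r → ℤ} :
    p ∈ chamberPaths r n y ↔ p 0 = startPoint r ∧ p (Fin.last n) = y ∧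
      (∀ i : Fin n, ∃ j, p i.succ = p i.castSucc + stepVec j) ∧ ∀ i, inC r (p i) := by
  induction n generalizing y with
  | zero =>
    simp only [chamberPaths]
    constructor
    · intro hp
      split_ifs at hp with hy
      · obtain rfl := mem_singleton.1 hp
        exact ⟨hy.1, rfl, fun i => i.elim0, fun _ => hy.2⟩
      · simp at hp
    · rintro ⟨h0, h1, -, h3⟩
      have hp : p = fun _ => y := by
        ext i : 1
        rw [Fin.fin_one_eq_zero i]
        exact h1
      rw [if_pos ⟨by rw [← h1]; exact h0, by rw [← h1]; exact h3 _⟩, hp, mem_singleton]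
  | succ n ih =>
    simp only [chamberPaths]
    constructor
    · intro hp
      split_ifs at hp with hy
      · simp only [mem_biUnion, mem_univ, true_and, mem_image] at hp
        obtain ⟨i, q, hq, rfl⟩ := hp
        obtain ⟨h0, h1, h2, h3⟩ := ih.1 hq
        refine ⟨by rw [Fin.snoc_apply_zero, h0], by rw [Fin.snoc_last], fun k => ?_, fun k => ?_⟩
        · induction k using Fin.lastCases with
          | last =>
            refine ⟨i, ?_⟩
            rw [Fin.succ_last, Fin.snoc_last, Fin.snoc_castSucc, h1, sub_add_cancel]
          | cast k =>
            obtain ⟨j, hj⟩ := h2 k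
            refine ⟨j, ?_⟩
            rw [← Fin.castSucc_succ, Fin.snoc_castSucc, Fin.snoc_castSucc, hj]
        · induction k using Fin.lastCases with
          | last => rwa [Fin.snoc_last]
          | cast k => rw [Fin.snoc_castSucc]; exact h3 k
      · simp at hp
    · rintro ⟨h0, rfl, h2, h3⟩
      rw [if_pos (h3 _)]
      simp only [mem_biUnion, mem_univ, true_and, mem_image]
      obtain ⟨j, hj⟩ := h2 (Fin.last n)
      refine ⟨j, Fin.init p, ih.2 ⟨h0, ?_, fun k => ?_, fun k => h3 _⟩, Fin.snoc_init_self p⟩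
      · rw [← Fin.succ_last, hj, add_sub_cancel_right]
        rfl
      · obtain ⟨i, hi⟩ := h2 k.castSucc
        exact ⟨i, by simpa [Fin.init] using hi⟩

lemma card_chamberPaths_succ {r n : ℕ} {y : Fin r → ℤ} (hy : inC r y) :
    (chamberPaths r (n + 1) y).card = ∑ i, (chamberPaths r n (y - stepVec i)).card := by
  rw [chamberPaths, if_pos hy, card_biUnion]
  · exact sum_congr rfl fun i _ => card_image_of_injective _
      (Fin.snoc_left_injective (α := fun _ => Fin r → ℤ) y)
  · intro i _ j _ hij
    rw [Function.onFun, disjoint_left]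
    simp only [mem_image, not_exists, not_and]
    rintro _ ⟨q, hq, rfl⟩ q' hq' heq
    obtain rfl := Fin.snoc_left_injective (α := fun _ => Fin r → ℤ) _ heq
    refine hij (stepVec_injective (sub_right_injective (b := y) ?_))
    exact (mem_chamberPaths.1 hq).2.1.symm.trans (mem_chamberPaths.1 hq').2.1

lemma chamberPaths_eq_empty {r n : ℕ} {y : Fin r → ℤ} (hy : ¬ inC r y) :
    chamberPaths r n y = ∅ := by
  refine eq_empty_of_forall_notMem fun p hp => hy ?_
  obtain ⟨-, h1, -, h3⟩ := mem_chamberPaths.1 hp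
  exact h1 ▸ h3 _

lemma StrictAnti.last_add_le {r : ℕ} {h : Fin (r + 1) → ℤ} (hh : StrictAnti h) (i : Fin (r + 1)) :
    h (Fin.last r) + r ≤ h i + (i : ℕ) := by
  induction i using Fin.reverseInduction with
  | last => simp
  | cast i ih =>
    have := hh (Fin.castSucc_lt_succ (i := i))
    simp only [Fin.val_succ, Fin.val_castSucc] at *
    push_cast at ih
    omega

lemma card_chamberPaths_zero {r : ℕ} {h : Fin (r + 1) → ℤ} (hh : StrictAnti h)
    (hsum : ∑ i, (h i + (i : ℕ)) = 0) :
    ((chamberPaths r 0 (chamberProj h)).card : ℚ) = tableauDet h := by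
  rcases lt_or_ge (h (Fin.last r) + r) 0 with hneg | hnonneg
  · have hdet : tableauDet h = 0 := by
      refine det_eq_zero_of_column_eq_zero (Fin.last r) fun j => ?_
      have := j.is_le
      exact invFactorial_of_neg (by omega)
    have hne : chamberProj h ≠ startPoint r := by
      intro heq
      have hi : ∀ i : Fin (r + 1), h i + (i : ℕ) = h (Fin.last r) + r := by
        intro i
        induction i using Fin.lastCases with
        | last => simp
        | cast i =>
          have := congrFun heq i
          simp only [chamberProj, startPoint] at this
          simp only [Fin.val_castSucc]
          omega
      rw [sum_congr rfl fun i _ => hi i] at hsum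
      simp only [sum_const, card_univ, Fintype.card_fin, nsmul_eq_mul] at hsum
      rcases mul_eq_zero.1 hsum with h0 | h0
      · norm_cast at h0
      · omega
    rw [chamberPaths, if_neg fun hc => hne hc.1, hdet]
    simp
  · have hi := (sum_eq_zero_iff_of_nonneg
      fun i _ => hnonneg.trans (hh.last_add_le i)).1 hsum
    have hid : h = fun i : Fin (r + 1) => -((i : ℕ) : ℤ) := by
      ext i
      have := hi i (mem_univ i)
      omega
    have hstart : chamberProj h = startPoint r := by
      ext k
      rw [hid]
      simp [chamberProj, startPoint]
      ring
    rw [chamberPaths, if_pos ⟨hstart, (inC_chamberProj_iff h).2 hh⟩, hid, tableauDet_neg_id]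
    simp

lemma StrictAnti.antitone_sub_single {n : ℕ} {h : Fin n → ℤ} (hh : StrictAnti h) (k : Fin n) :
    Antitone (h - Pi.single k 1) := by
  intro a b hab
  rcases hab.eq_or_lt with rfl | hlt
  · exact le_rfl
  · have := hh hlt
    simp only [Pi.sub_apply, Pi.single_apply]
    split_ifs <;> omega

/-- The number of paths to a point of the chamber, by the determinantal formula. -/
lemma card_chamberPaths {r n : ℕ} {h : Fin (r + 1) → ℤ} (hh : StrictAnti h)
    (hsum : ∑ i, (h i + (i : ℕ)) = n) :
    ((chamberPaths r n (chamberProj h)).card : ℚ) = n.factorial * tableauDet h := by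
  induction n generalizing h with
  | zero => simpa using card_chamberPaths_zero hh (by simpa using hsum)
  | succ n ih =>
    rw [card_chamberPaths_succ ((inC_chamberProj_iff h).2 hh), Nat.cast_sum]
    have hterm : ∀ k, ((chamberPaths r n (chamberProj h - stepVec k)).card : ℚ) =
        n.factorial * tableauDet (h - Pi.single k 1) := by
      intro k
      rw [stepVec, ← chamberProj_sub]
      by_cases hk : StrictAnti (h - Pi.single k 1)
      · refine ih hk ?_
        simp only [Pi.sub_apply, sum_add_distrib, sum_sub_distrib, sum_pi_single', mem_univ,
          if_true] at hsum ⊢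
        push_cast at hsum
        omega
      · rw [chamberPaths_eq_empty ((inC_chamberProj_iff _).not.2 hk),
          tableauDet_eq_zero_of_not_injective fun hinj =>
            hk ((hh.antitone_sub_single k).strictAnti_of_injective hinj)]
        simp
    rw [sum_congr rfl fun k _ => hterm k, ← mul_sum, sum_tableauDet_sub_single, hsum,
      Nat.factorial_succ]
    push_cast
    ring

lemma isGoodPath_ext_iff {r g : ℕ} (p : Fin (g + 1) → Fin r → ℤ) :
    IsGoodPath r g (ext g r p) ↔ p ∈ chamberPaths r g (startPoint r) := by
  have hext : ∀ i : Fin (g + 1), ext g r p i = p i := fun i => by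
    simp only [_root_.ext]
    congr 1
    ext
    simp [i.is_le]
  have h0 : ext g r p 0 = p 0 := hext 0
  have hg : ext g r p g = p (Fin.last g) := hext (Fin.last g)
  have hstep : ∀ i : Fin g, (negStep r (ext g r p) (i + 1) ∨ ∃ j, eStep r (ext g r p) (i + 1) j) ↔
      ∃ j, p i.succ = p i.castSucc + stepVec j := by
    intro i
    have hs : ext g r p ((i : ℕ) + 1) = p i.succ := hext i.succ
    have hc : ext g r p (i : ℕ) = p i.castSucc := hext i.castSucc
    rw [Fin.exists_fin_succ']
    simp only [negStep, eStep, Nat.add_sub_cancel, hs, hc, funext_iff, Pi.add_apply,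
      stepVec_castSucc, stepVec_last, ← sub_eq_add_neg]
    exact or_comm
  rw [mem_chamberPaths, IsGoodPath, h0, hg, funext_iff, funext_iff]
  refine and_congr Iff.rfl (and_congr Iff.rfl (and_congr ?_ ?_))
  · constructor
    · intro h i
      exact (hstep i).1 (h _ (by simp))
    · intro h i hi
      obtain ⟨h1, h2⟩ := mem_Icc.1 hi
      have := (hstep ⟨i - 1, by omega⟩).2 (h _)
      simpa only [Nat.sub_add_cancel h1] using this
  · constructor
    · intro h i
      exact hext i ▸ h i i.is_le
    · intro h i hi
      have := hext ⟨i, by omega⟩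
      simp only at this
      exact this ▸ h _

end

/-- With `g = (r+1)m`, the number of lattice paths `p 0, …, p g` in `ℤ^r` with
`p 0 = p g = (r, r−1, …, 1)`, all steps in `{e_0, …, e_{r−1}, (−1,…,−1)}`, staying in the
open Weyl chamber, is exactly `λ = g! · ∏_{i=0}^{r} i!/(m+i)!`. -/
theorem count_of_paths
    (r m : ℕ) (hr : 1 ≤ r) (hm : 1 ≤ m) (g : ℕ) (hg : g = (r + 1) * m) :
    (({p : Fin (g + 1) → Fin r → ℤ | IsGoodPath r g (ext g r p)}.ncard : ℚ)) =
      (g.factorial : ℚ) *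
        ∏ i ∈ Finset.range (r + 1), ((i.factorial : ℚ) / ((m + i).factorial : ℚ)) := by
  have hset : {p : Fin (g + 1) → Fin r → ℤ | IsGoodPath r g (ext g r p)} =
      (chamberPaths r g (startPoint r) : Set (Fin (g + 1) → Fin r → ℤ)) := by
    ext p
    exact isGoodPath_ext_iff p
  have hend : startPoint r = chamberProj fun i : Fin (r + 1) => (m : ℤ) - (i : ℕ) := by
    ext k
    simp [chamberProj, startPoint]
  have hanti : StrictAnti fun i : Fin (r + 1) => (m : ℤ) - (i : ℕ) := by
    intro a b hab
    have : (a : ℕ) < b := hab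
    simp only
    omega
  rw [hset, Set.ncard_coe_finset, hend, card_chamberPaths hanti, tableauDet_rectangle]
  simp [hg]
end

section
/- Let g ≥ 2, r ≥ 1 and d ≥ 0 be integers with ρ = g − (r+1)(g−d+r) ≥ 0. Then the chain-of-loops graph G_g has no effective divisor D of degree d and Baker–Norine rank equal to r whose coefficient at the vertex v_0 is at least r + ρ + 1 (i.e., no effective divisor of degree d and rank r containing (r+ρ+1)·v_0). -/
open scoped Classical

/-- Vertices of the chain-of-loops graph `G_g`: the distinguished vertices `v_0, …, v_g`
(the left summand) together with, for each loop `i` (for `1 ≤ i+1 ≤ g`), the `2g−3` internal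
vertices of the long path of the `(i+1)`-st loop (the right summand). -/
abbrev ChainV (g : ℕ) := Fin (g + 1) ⊕ (Fin g × Fin (2 * g - 3))

/-- Generating relation for the edges of `G_g`: for each `i : Fin g`, the `(i+1)`-st loop
consists of a direct edge `v_i — v_{i+1}` together with a path
`v_i — (i,0) — (i,1) — ⋯ — (i, 2g−4) — v_{i+1}` of `2g−2` edges, so each loop is a cycle of
length `2g−1` (realizing edge lengths `ℓ_i = 2g−2`, `m_i = 1`, which are generic). -/
def chainRel (g : ℕ) : ChainV g → ChainV g → Prop
  | Sum.inl a, Sum.inl b => (b : ℕ) = (a : ℕ) + 1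
  | Sum.inl a, Sum.inr (i, t) => (i : ℕ) = (a : ℕ) ∧ (t : ℕ) = 0
  | Sum.inr (i, t), Sum.inl b => (b : ℕ) = (i : ℕ) + 1 ∧ (t : ℕ) = 2 * g - 4
  | Sum.inr (i, t), Sum.inr (i', t') => i = i' ∧ (t' : ℕ) = (t : ℕ) + 1

/-- The chain-of-loops graph `G_g`. -/
def chainGraph (g : ℕ) : SimpleGraph (ChainV g) := SimpleGraph.fromRel (chainRel g)

/-- The graph Laplacian of `G_g` applied to an integer-valued function on the vertices. -/
noncomputable def lap (g : ℕ) (f : ChainV g → ℤ) (v : ChainV g) : ℤ :=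
  ∑ w : ChainV g, if (chainGraph g).Adj v w then f v - f w else 0

/-- A divisor is effective if all its coefficients are nonnegative. -/
def Eff (g : ℕ) (D : ChainV g → ℤ) : Prop := ∀ v, 0 ≤ D v

/-- Two divisors are linearly equivalent if their difference is in the image of the graph
Laplacian. -/
def LinEq (g : ℕ) (D D' : ChainV g → ℤ) : Prop :=
  ∃ f : ChainV g → ℤ, ∀ v, D v - D' v = lap g f v

/-- The Baker–Norine rank of `D` is at least `n`: for every effective divisor `E` of degree
`n`, the divisor `D − E` is linearly equivalent to an effective divisor. -/
def RankGe (g : ℕ) (D : ChainV g → ℤ) (n : ℕ) : Prop :=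
  ∀ E : ChainV g → ℤ, Eff g E → (∑ v, E v) = (n : ℤ) →
    ∃ D' : ChainV g → ℤ, Eff g D' ∧ LinEq g (fun v => D v - E v) D'

/-- Upper bound for the number of chips that can be carried across one loop of length `n`
when `c` chips are available at its left end; `z` is the class of the divisor on the loop. -/
def loopStep (n z c : ℤ) : ℤ :=
  if n ∣ z then (if n ∣ c then c else c - 1) else (if n ∣ c + 1 + z then c + 1 else c)

theorem le_loopStep {n z c w M y ε : ℤ} (hε : ε = if n ∣ z then 0 else 1) (hM : 0 ≤ M)
    (hdvd : M = 0 → n ∣ y + z) (hy : y = w - M + ε) (hw : w ≤ c) : y ≤ loopStep n z c := by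
  unfold loopStep
  by_cases hz : n ∣ z
  · simp only [hz, if_true] at hε ⊢
    split_ifs with hc
    · omega
    · by_contra hlt
      have hM0 : M = 0 := by omega
      have hyc : y = c := by omega
      exact hc (hyc ▸ (dvd_add_left hz).1 (hdvd hM0))
  · simp only [hz, if_false] at hε ⊢
    split_ifs with hc
    · omega
    · by_contra hlt
      have hM0 : M = 0 := by omega
      have hyc : y = c + 1 := by omega
      exact hc (hyc ▸ hdvd hM0)

theorem loopStep_neg {n z c : ℤ} (hc : c < 0) : loopStep n z c < 0 := by
  unfold loopStep
  split_ifs with hz h1 h2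
  · exact hc
  · omega
  · rcases eq_or_ne c (-1) with rfl | hne
    · exact absurd (by simpa using h2) hz
    · omega
  · exact hc

/-- The number of loops to the right of `v_i` carrying a chip of the `v_0`-reduced divisor whose
loop classes are `s`. -/
theorem exists_reduced_tail (n : ℤ) (g : ℕ) (s : ℕ → ℤ) :
    ∃ R : ℕ → ℤ, R g = 0 ∧
      ∀ i < g, R i = R (i + 1) + if n ∣ s i + R (i + 1) then 0 else 1 := by
  let ρ : ℕ → ℤ := fun k => Nat.rec 0
    (fun k x => x + if n ∣ s (g - 1 - k) + x then 0 else 1) k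
  refine ⟨fun i => ρ (g - i), by simp [ρ], fun i hi => ?_⟩
  obtain ⟨k, rfl⟩ : ∃ k, g = i + 1 + k := ⟨g - (i + 1), by omega⟩
  have h1 : i + 1 + k - i = k + 1 := by omega
  have h2 : i + 1 + k - (i + 1) = k := by omega
  have h3 : i + 1 + k - 1 - k = i := by omega
  simp only [h1, h2]
  change ρ k + (if n ∣ s (i + 1 + k - 1 - k) + ρ k then 0 else 1) = _
  rw [h3]

theorem Int.eq_of_dvd_sub_of_mem_range {n a b : ℤ} (h : n ∣ a - b) (ha : 1 ≤ a) (hb : 1 ≤ b)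
    (han : a < n) (hbn : b < n) : a = b := by
  have := Int.eq_zero_of_abs_lt_dvd h (by rw [abs_lt]; omega)
  omega

/-- One step of the lingering lattice path across a loop carrying a chip. -/
theorem exists_lattice_step {n z : ℤ} {r : ℕ} {q : ℕ → ℤ} {P : ℕ → ℤ → Prop} (hz : ¬ n ∣ z)
    (hq : ∀ j < r, 1 ≤ q j ∧ q j < n) (hanti : ∀ j, j + 1 < r → q (j + 1) < q j)
    (hstep : ∀ j < r, P j (loopStep n z (q j)))
    (hremove : ∀ j c, P j c → P (j + 1) (c - 1)) :
    ∃ q' : ℕ → ℤ, (∀ j, j + 1 < r → q' (j + 1) < q' j) ∧ (∀ j < r, P j (q' j)) ∧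
      (∀ j < r, q' j ≤ q j + 1) ∧
      ∑ j ∈ Finset.range r, q' j ≤ ∑ j ∈ Finset.range r, q j + 1 := by
  have hstay : ∀ j < r, ¬ n ∣ q j + 1 + z → P j (q j) := by
    intro j hj hn
    simpa [loopStep, hz, hn] using hstep j hj
  have hanti' : ∀ k j, j < k → k < r → q k < q j := by
    intro k
    induction k with
    | zero => intro j hj; omega
    | succ k ih =>
      intro j hj hk
      have := hanti k hk
      rcases (Nat.lt_succ_iff_lt_or_eq.1 hj) with h | rfl
      · have := ih j h (by omega); omega
      · exact this
  by_cases hex : ∃ j < r, n ∣ q j + 1 + z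
  · obtain ⟨j, hj, hjd⟩ := hex
    have huniq : ∀ k < r, k ≠ j → ¬ n ∣ q k + 1 + z := by
      intro k hk hkj hkd
      have h := dvd_sub hkd hjd
      rw [show q k + 1 + z - (q j + 1 + z) = q k - q j by ring] at h
      have heq := Int.eq_of_dvd_sub_of_mem_range h (hq k hk).1 (hq j hj).1 (hq k hk).2 (hq j hj).2
      rcases lt_or_gt_of_ne hkj with hlt | hlt
      · have := hanti' _ _ hlt hj; omega
      · have := hanti' _ _ hlt hk; omega
    have hup : P j (q j + 1) := by simpa [loopStep, hz, hjd] using hstep j hj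
    by_cases hroom : j = 0 ∨ q j + 1 < q (j - 1)
    · refine ⟨Function.update q j (q j + 1), ?_, ?_, ?_, ?_⟩
      · intro k hk
        have hk' := hanti k hk
        rcases eq_or_ne k j with rfl | h1
        · simp; omega
        · rcases eq_or_ne (k + 1) j with h2 | h2
          · subst h2
            simp at hroom
            simpa [h1] using hroom
          · simpa [h1, h2] using hk'
      · intro k hk
        rcases eq_or_ne k j with rfl | h1
        · simpa using hup
        · simpa [h1] using hstay k hk (huniq k hk h1)
      · intro k hk
        rcases eq_or_ne k j with rfl | h1
        · simp
        · simp [h1]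
      · rw [Finset.sum_update_of_mem (Finset.mem_range.2 hj),
          ← Finset.add_sum_erase _ _ (Finset.mem_range.2 hj), Finset.sdiff_singleton_eq_erase]
        omega
    · push Not at hroom
      obtain ⟨hj0, hle⟩ := hroom
      obtain ⟨k, rfl⟩ : ∃ k, j = k + 1 := ⟨j - 1, by omega⟩
      have hk := hanti k hj
      simp only [Nat.add_sub_cancel] at hle
      have hqk : q k = q (k + 1) + 1 := by omega
      refine ⟨q, hanti, fun l hl => ?_, fun l _ => by omega, by omega⟩
      rcases eq_or_ne l (k + 1) with rfl | h1
      · have := hremove k _ (hstay k (by omega) (huniq k (by omega) (by omega)))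
        rwa [hqk, add_sub_cancel_right] at this
      · exact hstay l hl (huniq l hl h1)
  · push Not at hex
    exact ⟨q, hanti, fun l hl => hstay l hl (hex l hl), fun l _ => by omega, by omega⟩

/-- Counting steps of a lingering lattice path that stays in the open Weyl chamber. -/
theorem lattice_path_bound {n d₀ : ℤ} {g r : ℕ} {s R : ℕ → ℤ} {P : ℕ → ℕ → ℤ → Prop}
    (hRg : R g = 0)
    (hR : ∀ i < g, R i = R (i + 1) + if n ∣ s i + R (i + 1) then 0 else 1)
    (hn : d₀ + R 0 < n) (hstart : P 0 0 d₀)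
    (hremove : ∀ i ≤ g, ∀ j c, P i j c → P i (j + 1) (c - 1))
    (hstep : ∀ i < g, ∀ j c, P i j c → P (i + 1) j (loopStep n (s i + R (i + 1)) c))
    (hnonneg : ∀ i ≤ g, ∀ j ≤ r, ∀ c, P i j c → 0 ≤ c) :
    (r : ℤ) * r ≤ r * d₀ - r * (g - R 0) + R 0 := by
  have hRnonneg : ∀ k ≤ g, 0 ≤ R (g - k) := by
    intro k
    induction k with
    | zero => intro _; simp [hRg]
    | succ k ih =>
      intro hk
      have h1 := ih (by omega)
      have h2 := hR (g - (k + 1)) (by omega)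
      rw [show g - (k + 1) + 1 = g - k by omega] at h2
      split_ifs at h2 <;> omega
  have hpos : ∀ i ≤ g, ∀ j < r, ∀ c, P i j c → 1 ≤ c := by
    intro i hi j hj c hc
    have := hnonneg i hi (j + 1) (by omega) _ (hremove i hi j c hc)
    omega
  have key : ∀ i ≤ g, ∃ q : ℕ → ℤ, (∀ j, j + 1 < r → q (j + 1) < q j) ∧
      (∀ j < r, P i j (q j)) ∧ (∀ j < r, q j ≤ d₀ + (R 0 - R i)) ∧
      ∑ j ∈ Finset.range r, q j ≤
        ∑ j ∈ Finset.range r, (d₀ - j) - r * (i - (R 0 - R i)) + (R 0 - R i) := by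
    intro i
    induction i with
    | zero =>
      intro _
      refine ⟨fun j => d₀ - j, fun j _ => by push_cast; omega, fun j _ => ?_,
        fun j _ => by simp, by simp⟩
      induction j with
      | zero => simpa using hstart
      | succ j ih =>
        have := hremove 0 (by omega) j _ (ih (by omega))
        simpa [sub_sub] using this
    | succ i ih =>
      intro hi
      obtain ⟨q, hanti, hP, hle, hsum⟩ := ih (by omega)
      have hRi := hR i (by omega)
      have hRi0 : 0 ≤ R i := by
        simpa [Nat.sub_sub_self (show i ≤ g by omega)] using hRnonneg (g - i) (by omega)
      have hq : ∀ j < r, 1 ≤ q j ∧ q j < n := fun j hj =>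
        ⟨hpos i (by omega) j hj _ (hP j hj), by have := hle j hj; omega⟩
      by_cases hz : n ∣ s i + R (i + 1)
      · simp only [hz, if_true, add_zero] at hRi
        refine ⟨fun j => q j - 1, fun j hj => by simpa using hanti j hj, fun j hj => ?_,
          fun j hj => by have := hle j hj; dsimp only; omega, ?_⟩
        · have hnd : ¬ n ∣ q j := fun hd => by
            have := Int.le_of_dvd (by have := hq j hj; omega) hd
            have := hq j hj
            omega
          simpa [loopStep, hz, hnd] using hstep i (by omega) j _ (hP j hj)
        · rw [Finset.sum_sub_distrib]
          rw [hRi] at hsum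
          simp only [Finset.sum_const, Finset.card_range, nsmul_eq_mul, mul_one]
          push_cast
          linarith
      · simp only [hz, if_false] at hRi
        obtain ⟨q', h1, h2, h3, h4⟩ := exists_lattice_step (P := P (i + 1)) hz hq hanti
          (fun j hj => hstep i (by omega) j _ (hP j hj)) (hremove (i + 1) hi)
        refine ⟨q', h1, h2, fun j hj => by have := hle j hj; have := h3 j hj; omega, ?_⟩
        rw [hRi] at hsum
        push_cast
        linarith
  obtain ⟨q, hanti, hP, -, hsum⟩ := key g le_rfl
  have hlow : ∀ k j, j + k + 1 = r → (k : ℤ) + 1 ≤ q j := by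
    intro k
    induction k with
    | zero => intro j hj; simpa using hpos g le_rfl j (by omega) _ (hP j (by omega))
    | succ k ih =>
      intro j hj
      have := ih (j + 1) (by omega)
      have := hanti j (by omega)
      push_cast
      omega
  have hsum' : ∑ j ∈ Finset.range r, ((r : ℤ) - j) ≤ ∑ j ∈ Finset.range r, q j := by
    refine Finset.sum_le_sum fun j hj => ?_
    have hj := Finset.mem_range.1 hj
    have := hlow (r - 1 - j) j (by omega)
    omega
  rw [hRg] at hsum
  simp only [Finset.sum_sub_distrib, Finset.sum_const, Finset.card_range, nsmul_eq_mul] at hsum hsum'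
  linarith

/-- Indicator function of the vertices of `G_g` at or to the right of `v_i`. -/
def tailInd (g i : ℕ) : ChainV g → ℤ
  | Sum.inl a => if i ≤ (a : ℕ) then 1 else 0
  | Sum.inr (j, _) => if i ≤ (j : ℕ) then 1 else 0

/-- Indicator function of the internal vertices of the loop joining `v_i` to `v_{i+1}`. -/
def interiorInd (g i : ℕ) : ChainV g → ℤ
  | Sum.inl _ => 0
  | Sum.inr (j, _) => if (j : ℕ) = i then 1 else 0

/-- Distance from `v_i` along the long path, on the internal vertices of the loop joining `v_i`
to `v_{i+1}`. -/
def interiorPos (g i : ℕ) : ChainV g → ℤ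
  | Sum.inl _ => 0
  | Sum.inr (j, t) => if (j : ℕ) = i then (t : ℤ) + 1 else 0

theorem chainRel_asymm {g : ℕ} {v w : ChainV g} (h : chainRel g v w) : ¬ chainRel g w v := by
  rcases v with a | ⟨i, t⟩ <;> rcases w with b | ⟨j, u⟩ <;> simp only [chainRel] at h ⊢ <;> omega

theorem sum_lap_mul (g : ℕ) (f h : ChainV g → ℤ) :
    ∑ v, lap g f v * h v =
      ∑ v, ∑ w, if chainRel g v w then (f v - f w) * (h v - h w) else 0 := by
  have hsplit : ∀ v, lap g f v * h v =
      ∑ w, (if chainRel g v w then (f v - f w) * h v else 0) +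
        ∑ w, (if chainRel g w v then (f v - f w) * h v else 0) := by
    intro v
    rw [lap, Finset.sum_mul, ← Finset.sum_add_distrib]
    refine Finset.sum_congr rfl fun w _ => ?_
    simp only [chainGraph, SimpleGraph.fromRel_adj]
    by_cases h1 : chainRel g v w
    · have h2 := chainRel_asymm h1
      have h3 : v ≠ w := by rintro rfl; exact h2 h1
      simp [h1, h2, h3]
    · by_cases h2 : chainRel g w v
      · have h3 : v ≠ w := by rintro rfl; exact h1 h2
        simp [h1, h2, h3]
      · simp [h1, h2]
  rw [Finset.sum_congr rfl fun v _ => hsplit v, Finset.sum_add_distrib,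
    Finset.sum_comm (f := fun v w => if chainRel g w v then (f v - f w) * h v else 0),
    ← Finset.sum_add_distrib]
  refine Finset.sum_congr rfl fun v _ => ?_
  rw [← Finset.sum_add_distrib]
  refine Finset.sum_congr rfl fun w _ => ?_
  split_ifs <;> ring

theorem sum_lap (g : ℕ) (f : ChainV g → ℤ) : ∑ v, lap g f v = 0 := by
  simpa using sum_lap_mul g f (fun _ => 1)

theorem sum_consecutive_sub (m : ℕ) (hm : 0 < m) (F : Fin m → ℤ) :
    (∑ t : Fin m, ∑ u : Fin m, if (u : ℕ) = t + 1 then F t - F u else 0) =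
      F ⟨0, hm⟩ - F ⟨m - 1, by omega⟩ := by
  obtain ⟨k, rfl⟩ : ∃ k, m = k + 1 := ⟨m - 1, by omega⟩
  have hlast : (∑ u : Fin (k + 1), if (u : ℕ) = (Fin.last k : ℕ) + 1 then
      F (Fin.last k) - F u else 0) = 0 := by
    refine Finset.sum_eq_zero fun u _ => if_neg ?_
    have := u.2
    simp only [Fin.val_last]
    omega
  have hcast : ∀ t : Fin k, (∑ u : Fin (k + 1), if (u : ℕ) = (t.castSucc : ℕ) + 1 then
      F t.castSucc - F u else 0) = F t.castSucc - F t.succ := by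
    intro t
    rw [Finset.sum_eq_single t.succ]
    · simp
    · intro u _ hu
      refine if_neg fun h => hu (Fin.ext ?_)
      simpa using h
    · simp
  rw [Fin.sum_univ_castSucc, hlast, Finset.sum_congr rfl fun t _ => hcast t, add_zero,
    Finset.sum_sub_distrib]
  have h1 := Fin.sum_univ_castSucc F
  have h2 := Fin.sum_univ_succ F
  have h3 : (⟨k + 1 - 1, by omega⟩ : Fin (k + 1)) = Fin.last k := by ext; simp
  have h4 : (⟨0, hm⟩ : Fin (k + 1)) = 0 := rfl
  rw [h3, h4]
  linarith

theorem sum_sum_eq_single {α β : Type*} [Fintype α] [Fintype β] {a : α} {b : β} {c : ℤ}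
    {G : α → β → ℤ} (hab : G a b = c) (h : ∀ x y, G x y ≠ 0 → x = a ∧ y = b) :
    ∑ x, ∑ y, G x y = c := by
  rw [Finset.sum_eq_single a, Finset.sum_eq_single b, hab]
  · intro y _ hy
    by_contra h0
    exact hy (h a y h0).2
  · simp
  · intro x _ hx
    refine Finset.sum_eq_zero fun y _ => ?_
    by_contra h0
    exact hx (h x y h0).1
  · simp

/-- The position on the loop joining `v_i` to `v_{i+1}` of the retraction of a vertex of `G_g`
to this loop. -/
def loopPos (g i : ℕ) (v : ChainV g) : ℤ :=
  interiorPos g i v + (2 * (g : ℤ) - 2) * tailInd g (i + 1) v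

/-- The class of a principal divisor on each loop vanishes. -/
theorem dvd_sum_lap_mul (g : ℕ) (hg : 2 ≤ g) (i : ℕ) (hi : i < g) (f : ChainV g → ℤ) :
    (2 * (g : ℤ) - 1) ∣ ∑ v, lap g f v * loopPos g i v := by
  set A := f (Sum.inl ⟨i, by omega⟩) with hA
  set B := f (Sum.inl ⟨i + 1, by omega⟩) with hB
  set F : Fin (2 * g - 3) → ℤ := fun t => f (Sum.inr (⟨i, hi⟩, t)) with hF
  have hm : 0 < 2 * g - 3 := by omega
  rw [sum_lap_mul, Fintype.sum_sum_type]
  simp only [Fintype.sum_sum_type, Finset.sum_add_distrib]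
  have h1 : (∑ a : Fin (g + 1), ∑ b : Fin (g + 1),
      if chainRel g (Sum.inl a) (Sum.inl b) then (f (Sum.inl a) - f (Sum.inl b)) *
        (loopPos g i (Sum.inl a) - loopPos g i (Sum.inl b)) else 0) =
      -(2 * (g : ℤ) - 2) * (A - B) := by
    refine sum_sum_eq_single (a := ⟨i, by omega⟩) (b := ⟨i + 1, by omega⟩) ?_ fun a b h => ?_
    · rw [if_pos (by simp [chainRel])]
      simp only [loopPos, interiorPos, tailInd, ← hA, ← hB]
      simp
      ring
    · rw [ite_ne_right_iff] at h
      obtain ⟨hrel, hne⟩ := h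
      simp only [chainRel] at hrel
      have hpos := sub_ne_zero.1 (right_ne_zero_of_mul hne)
      simp only [loopPos, interiorPos, tailInd] at hpos
      simp only [Fin.ext_iff]
      split_ifs at hpos <;> omega
  have h2 : (∑ a : Fin (g + 1), ∑ p : Fin g × Fin (2 * g - 3),
      if chainRel g (Sum.inl a) (Sum.inr p) then (f (Sum.inl a) - f (Sum.inr p)) *
        (loopPos g i (Sum.inl a) - loopPos g i (Sum.inr p)) else 0) = -(A - F ⟨0, hm⟩) := by
    refine sum_sum_eq_single (a := ⟨i, by omega⟩) (b := (⟨i, hi⟩, ⟨0, hm⟩)) ?_ fun a p h => ?_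
    · rw [if_pos (by simp [chainRel])]
      simp only [loopPos, interiorPos, tailInd, ← hA, hF]
      simp
    · rw [ite_ne_right_iff] at h
      obtain ⟨hrel, hne⟩ := h
      obtain ⟨j, t⟩ := p
      simp only [chainRel] at hrel
      have hpos := sub_ne_zero.1 (right_ne_zero_of_mul hne)
      simp only [loopPos, interiorPos, tailInd] at hpos
      simp only [Fin.ext_iff, Prod.mk.injEq]
      split_ifs at hpos <;> omega
  have h3 : (∑ p : Fin g × Fin (2 * g - 3), ∑ b : Fin (g + 1),
      if chainRel g (Sum.inr p) (Sum.inl b) then (f (Sum.inr p) - f (Sum.inl b)) *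
        (loopPos g i (Sum.inr p) - loopPos g i (Sum.inl b)) else 0) =
      -(F ⟨2 * g - 3 - 1, by omega⟩ - B) := by
    refine sum_sum_eq_single (a := (⟨i, hi⟩, ⟨2 * g - 3 - 1, by omega⟩)) (b := ⟨i + 1, by omega⟩)
      ?_ fun p b h => ?_
    · rw [if_pos (by exact ⟨rfl, show 2 * g - 3 - 1 = 2 * g - 4 by omega⟩)]
      have he : ((2 * g - 3 - 1 : ℕ) : ℤ) = 2 * g - 4 := by omega
      simp only [loopPos, interiorPos, tailInd, ← hB, hF, he]
      simp
      ring
    · rw [ite_ne_right_iff] at h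
      obtain ⟨hrel, hne⟩ := h
      obtain ⟨j, t⟩ := p
      simp only [chainRel] at hrel
      have hpos := sub_ne_zero.1 (right_ne_zero_of_mul hne)
      simp only [loopPos, interiorPos, tailInd] at hpos
      simp only [Fin.ext_iff, Prod.mk.injEq]
      split_ifs at hpos <;> omega
  have h4 : (∑ p : Fin g × Fin (2 * g - 3), ∑ p' : Fin g × Fin (2 * g - 3),
      if chainRel g (Sum.inr p) (Sum.inr p') then (f (Sum.inr p) - f (Sum.inr p')) *
        (loopPos g i (Sum.inr p) - loopPos g i (Sum.inr p')) else 0) =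
      -(F ⟨0, hm⟩ - F ⟨2 * g - 3 - 1, by omega⟩) := by
    rw [← sum_consecutive_sub (2 * g - 3) hm F]
    simp only [Fintype.sum_prod_type, ← Finset.sum_neg_distrib]
    rw [Finset.sum_eq_single (⟨i, hi⟩ : Fin g)]
    · refine Finset.sum_congr rfl fun t _ => ?_
      rw [Finset.sum_eq_single (⟨i, hi⟩ : Fin g)]
      · refine Finset.sum_congr rfl fun u _ => ?_
        by_cases hu : (u : ℕ) = t + 1
        · rw [if_pos (by simpa [chainRel] using hu), if_pos hu]
          simp only [loopPos, interiorPos, tailInd, hF, hu]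
          push_cast
          simp
        · rw [if_neg (by simpa [chainRel] using hu), if_neg hu, neg_zero]
      · intro j _ hj
        exact Finset.sum_eq_zero fun u _ => if_neg fun h => hj h.1.symm
      · simp
    · intro j _ hj
      have hj' : (j : ℕ) ≠ i := fun h => hj (Fin.ext h)
      refine Finset.sum_eq_zero fun t _ => Finset.sum_eq_zero fun k _ =>
        Finset.sum_eq_zero fun u _ => ?_
      split_ifs with h
      · obtain ⟨rfl, -⟩ := h
        simp [loopPos, interiorPos, tailInd, hj']
      · rfl
    · simp
  rw [h1, h2, h3, h4]
  exact ⟨-(A - B), by ring⟩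

/-- Number of chips of a divisor at or to the right of `v_i`. -/
def tailDeg (g : ℕ) (F : ChainV g → ℤ) (i : ℕ) : ℤ := ∑ v, F v * tailInd g i v

/-- Number of chips of a divisor inside the loop joining `v_i` to `v_{i+1}`. -/
def interiorDeg (g : ℕ) (F : ChainV g → ℤ) (i : ℕ) : ℤ := ∑ v, F v * interiorInd g i v

/-- The class of a divisor on the loop joining `v_i` to `v_{i+1}`, as an integer which is
meaningful modulo the length of the loop. -/
def loopClass (g : ℕ) (F : ChainV g → ℤ) (i : ℕ) : ℤ :=
  ∑ v, F v * interiorPos g i v - tailDeg g F (i + 1)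

theorem tailDeg_zero (g : ℕ) (F : ChainV g → ℤ) : tailDeg g F 0 = ∑ v, F v := by
  refine Finset.sum_congr rfl fun v _ => ?_
  rcases v with a | ⟨j, t⟩ <;> simp [tailInd]

theorem tailDeg_eq (g : ℕ) (F : ChainV g → ℤ) (i : ℕ) (hi : i < g + 1) :
    tailDeg g F i = F (Sum.inl ⟨i, hi⟩) + interiorDeg g F i + tailDeg g F (i + 1) := by
  have h : F (Sum.inl ⟨i, hi⟩) = ∑ v, if v = Sum.inl ⟨i, hi⟩ then F v else 0 := by simp
  rw [h, tailDeg, interiorDeg, tailDeg, ← Finset.sum_add_distrib, ← Finset.sum_add_distrib]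
  refine Finset.sum_congr rfl fun v _ => ?_
  rcases v with a | ⟨j, t⟩
  · simp only [tailInd, interiorInd, Sum.inl.injEq, Fin.ext_iff]
    split_ifs <;> omega
  · simp only [tailInd, interiorInd, reduceCtorEq, if_false]
    split_ifs <;> omega

theorem tailDeg_last (g : ℕ) (F : ChainV g → ℤ) : tailDeg g F g = F (Sum.inl (Fin.last g)) := by
  have h1 : interiorDeg g F g = 0 := by
    refine Finset.sum_eq_zero fun v _ => ?_
    rcases v with a | ⟨j, t⟩
    · simp [interiorInd]
    · simp [interiorInd, j.2.ne]
  have h2 : tailDeg g F (g + 1) = 0 := by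
    refine Finset.sum_eq_zero fun v _ => ?_
    rcases v with a | ⟨j, t⟩
    · have := a.2
      simp only [tailInd]
      rw [if_neg (by omega), mul_zero]
    · have := j.2
      simp only [tailInd]
      rw [if_neg (by omega), mul_zero]
  rw [tailDeg_eq g F g (by omega), h1, h2, add_zero, add_zero]
  rfl

theorem interiorInd_nonneg (g i : ℕ) (v : ChainV g) : 0 ≤ interiorInd g i v := by
  rcases v with a | ⟨j, t⟩
  · simp [interiorInd]
  · simp only [interiorInd]
    split_ifs <;> simp

theorem interiorDeg_nonneg {g : ℕ} {F : ChainV g → ℤ} (hF : Eff g F) (i : ℕ) :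
    0 ≤ interiorDeg g F i :=
  Finset.sum_nonneg fun v _ => mul_nonneg (hF v) (interiorInd_nonneg g i v)

theorem loopClass_of_interiorDeg_eq_zero {g : ℕ} {F : ChainV g → ℤ} (hF : Eff g F) {i : ℕ}
    (h : interiorDeg g F i = 0) : loopClass g F i = - tailDeg g F (i + 1) := by
  have h' := (Finset.sum_eq_zero_iff_of_nonneg fun v _ =>
    mul_nonneg (hF v) (interiorInd_nonneg g i v)).1 h
  have : ∑ v, F v * interiorPos g i v = 0 := by
    refine Finset.sum_eq_zero fun v hv => ?_
    have h0 := h' v hv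
    rcases v with a | ⟨j, t⟩
    · simp [interiorPos]
    · simp only [interiorInd, interiorPos] at h0 ⊢
      split_ifs at h0 ⊢ with hj
      · rw [mul_one] at h0
        rw [h0, zero_mul]
      · simp
  rw [loopClass, this, zero_sub]

theorem LinEq.sum_eq {g : ℕ} {D F : ChainV g → ℤ} (h : LinEq g D F) :
    ∑ v, D v = ∑ v, F v := by
  obtain ⟨f, hf⟩ := h
  have := sum_lap g f
  simp only [← hf, Finset.sum_sub_distrib] at this
  omega

theorem LinEq.loopClass_dvd {g : ℕ} (hg : 2 ≤ g) {D F : ChainV g → ℤ} (h : LinEq g D F)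
    {i : ℕ} (hi : i < g) : (2 * (g : ℤ) - 1) ∣ loopClass g D i - loopClass g F i := by
  obtain ⟨f, hf⟩ := h
  have hd := dvd_sum_lap_mul g hg i hi f
  have key : ∑ v, lap g f v * loopPos g i v =
      (loopClass g D i - loopClass g F i) +
        (2 * (g : ℤ) - 1) * (tailDeg g D (i + 1) - tailDeg g F (i + 1)) := by
    simp only [loopPos, loopClass, tailDeg, ← Finset.sum_sub_distrib, Finset.mul_sum,
      ← Finset.sum_add_distrib]
    refine Finset.sum_congr rfl fun v _ => ?_
    rw [← hf]
    ring
  rw [key] at hd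
  exact (dvd_add_left (dvd_mul_right _ _)).1 hd

/-- `ChipBound D R i j c`: some `j` chips can be prescribed so that an effective divisor
equivalent to `D` containing them has at most `c` further chips at or to the right of `v_i`
in excess of `R i`. -/
def ChipBound (g : ℕ) (D : ChainV g → ℤ) (R : ℕ → ℤ) (i j : ℕ) (c : ℤ) : Prop :=
  ∃ E : ChainV g → ℤ, Eff g E ∧ ∑ v, E v = j ∧ ∀ hi : i < g + 1, ∀ F : ChainV g → ℤ,
    (∀ v, E v ≤ F v) → LinEq g D F →
      tailDeg g F i - R i - E (Sum.inl ⟨i, hi⟩) ≤ c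

theorem ChipBound.remove {g : ℕ} {D : ChainV g → ℤ} {R : ℕ → ℤ} {i : ℕ} (hi : i ≤ g) {j : ℕ}
    {c : ℤ} (h : ChipBound g D R i j c) : ChipBound g D R i (j + 1) (c - 1) := by
  obtain ⟨E, hE, hdeg, hb⟩ := h
  set v₀ : ChainV g := Sum.inl ⟨i, by omega⟩ with hv₀
  refine ⟨fun v => E v + if v = v₀ then 1 else 0, fun v => ?_, ?_, fun hi' F hF hDF => ?_⟩
  · have := hE v
    dsimp only
    split_ifs <;> omega
  · simp [Finset.sum_add_distrib, hdeg]
  · have h1 := hb hi' F (fun v => by have := hF v; dsimp only at this; split_ifs at this <;> omega)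
      hDF
    simp only [← hv₀, if_true] at h1 ⊢
    omega

/-- Effective divisors obey the step rule across the loop joining `v_i` to `v_{i+1}`. -/
theorem tailDeg_step {g : ℕ} (hg : 2 ≤ g) {D F : ChainV g → ℤ} {R : ℕ → ℤ}
    (hR : ∀ i < g, R i = R (i + 1) +
      if (2 * (g : ℤ) - 1) ∣ loopClass g D i + R (i + 1) then 0 else 1)
    (hF : Eff g F) (hDF : LinEq g D F) {i : ℕ} (hi : i < g) {c : ℤ}
    (hc : tailDeg g F i - R i - F (Sum.inl ⟨i, by omega⟩) ≤ c) :
    tailDeg g F (i + 1) - R (i + 1) ≤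
      loopStep (2 * (g : ℤ) - 1) (loopClass g D i + R (i + 1)) c := by
  have ht := tailDeg_eq g F i (by omega)
  refine le_loopStep (ε := R i - R (i + 1)) (M := interiorDeg g F i) (by rw [hR i hi]; ring)
    (interiorDeg_nonneg hF i) (fun h0 => ?_) (by rw [ht]; ring) hc
  have h1 := hDF.loopClass_dvd hg hi
  rw [loopClass_of_interiorDeg_eq_zero hF h0] at h1
  convert h1 using 1
  ring

theorem ChipBound.step {g : ℕ} (hg : 2 ≤ g) {D : ChainV g → ℤ} {R : ℕ → ℤ}
    (hR : ∀ i < g, R i = R (i + 1) +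
      if (2 * (g : ℤ) - 1) ∣ loopClass g D i + R (i + 1) then 0 else 1)
    {i : ℕ} (hi : i < g) {j : ℕ} {c : ℤ} (h : ChipBound g D R i j c) :
    ChipBound g D R (i + 1) j
      (loopStep (2 * (g : ℤ) - 1) (loopClass g D i + R (i + 1)) c) := by
  obtain ⟨E, hE, hdeg, hb⟩ := h
  refine ⟨E, hE, hdeg, fun hi' F hF hDF => ?_⟩
  have hFeff : Eff g F := fun v => (hE v).trans (hF v)
  have h1 := hb (by omega) F hF hDF
  have h2 := hF (Sum.inl ⟨i, by omega⟩)
  have h3 := tailDeg_step hg hR hFeff hDF hi (c := c) (by omega)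
  have h4 := hE (Sum.inl ⟨i + 1, hi'⟩)
  omega

theorem ChipBound.nonneg {g : ℕ} (hg : 2 ≤ g) {D : ChainV g → ℤ} {R : ℕ → ℤ} (hRg : R g = 0)
    (hR : ∀ i < g, R i = R (i + 1) +
      if (2 * (g : ℤ) - 1) ∣ loopClass g D i + R (i + 1) then 0 else 1)
    {r : ℕ} (hrank : RankGe g D r) {i : ℕ} (hi : i ≤ g) {j : ℕ} (hj : j ≤ r) {c : ℤ}
    (h : ChipBound g D R i j c) : 0 ≤ c := by
  by_contra! hneg
  have hpad : ∀ k, ∃ c' < 0, ChipBound g D R i (j + k) c' := by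
    intro k
    induction k with
    | zero => exact ⟨c, hneg, h⟩
    | succ k ih =>
      obtain ⟨c', hc', hb⟩ := ih
      exact ⟨c' - 1, by omega, hb.remove hi⟩
  have hprop : ∀ k, i + k ≤ g → ∃ c' < 0, ChipBound g D R (i + k) r c' := by
    intro k
    induction k with
    | zero =>
      intro _
      simpa [Nat.add_sub_cancel' hj] using hpad (r - j)
    | succ k ih =>
      intro hk
      obtain ⟨c', hc', hb⟩ := ih (by omega)
      exact ⟨_, loopStep_neg hc', hb.step hg hR (by omega)⟩
  obtain ⟨c', hc', hb⟩ := hprop (g - i) (by omega)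
  rw [Nat.add_sub_cancel' hi] at hb
  obtain ⟨E, hE, hdeg, hb⟩ := hb
  obtain ⟨D', hD', f, hf⟩ := hrank E hE hdeg
  have h1 := hb (by omega) (fun v => D' v + E v) (fun v => by have := hD' v; omega)
    ⟨f, fun v => by rw [← hf v]; ring⟩
  rw [tailDeg_last, hRg] at h1
  have h2 := hD' (Sum.inl (Fin.last g))
  change D' (Sum.inl (Fin.last g)) + E (Sum.inl (Fin.last g)) - 0 - E (Sum.inl (Fin.last g)) ≤ c'
    at h1
  omega

/-- Among effective divisors, the reduced one has the fewest chips to the right of `v_i`. -/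
theorem reduced_tail_le {g : ℕ} {D : ChainV g → ℤ} (hD : Eff g D) {R : ℕ → ℤ}
    (hRg : R g = 0) {n : ℤ}
    (hR : ∀ i < g, R i = R (i + 1) + if n ∣ loopClass g D i + R (i + 1) then 0 else 1)
    (k : ℕ) (hk : k ≤ g) :
    R (g - k) ≤ tailDeg g D (g - k) - D (Sum.inl ⟨g - k, by omega⟩) := by
  induction k with
  | zero =>
    change R g ≤ tailDeg g D g - D (Sum.inl (Fin.last g))
    rw [tailDeg_last, hRg, sub_self]
  | succ k ih =>
    have h1 := ih (by omega)
    obtain ⟨i, hik⟩ : ∃ i, g - (k + 1) = i := ⟨_, rfl⟩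
    have hik' : g - k = i + 1 := by omega
    simp only [hik, hik'] at h1 ⊢
    have h2 := hR i (by omega)
    have h3 := tailDeg_eq g D i (by omega)
    have h4 := interiorDeg_nonneg hD i
    have h5 := hD (Sum.inl ⟨i + 1, by omega⟩)
    by_contra! hlt
    split_ifs at h2 with hdvd
    · omega
    · have h6 := loopClass_of_interiorDeg_eq_zero hD (i := i) (by omega)
      exact hdvd ⟨0, by rw [h6]; omega⟩

/-- If `ρ = g − (r+1)(g−d+r) ≥ 0`, then the chain-of-loops graph `G_g` has no effective
divisor of degree `d` and Baker–Norine rank equal to `r` whose coefficient at the vertex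
`v_0` is at least `r + ρ + 1`, i.e. containing `(r+ρ+1)·v_0`. -/
theorem no_special_divisors_containing_v0
    (g : ℕ) (hg : 2 ≤ g) (r d : ℕ) (hr : 1 ≤ r)
    (hρ : 0 ≤ (g : ℤ) - ((r : ℤ) + 1) * ((g : ℤ) - (d : ℤ) + (r : ℤ))) :
    ¬ ∃ D : ChainV g → ℤ, Eff g D ∧ (∑ v, D v) = (d : ℤ) ∧
        RankGe g D r ∧ ¬ RankGe g D (r + 1) ∧
        (r : ℤ) + ((g : ℤ) - ((r : ℤ) + 1) * ((g : ℤ) - (d : ℤ) + (r : ℤ))) + 1 ≤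
          D (Sum.inl 0) := by
  rintro ⟨D, hD, hdeg, hrank, -, hv⟩
  obtain ⟨R, hRg, hR⟩ := exists_reduced_tail (2 * (g : ℤ) - 1) g (loopClass g D)
  have hR0 := reduced_tail_le hD hRg hR g le_rfl
  simp only [Nat.sub_self] at hR0
  change R 0 ≤ tailDeg g D 0 - D (Sum.inl 0) at hR0
  rw [tailDeg_zero, hdeg] at hR0
  have hRnonneg : (0 : ℤ) ≤ d - D (Sum.inl 0) := by
    rw [← hdeg, sub_nonneg]
    exact Finset.single_le_sum (fun v _ => hD v) (Finset.mem_univ _)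
  have hs : 1 ≤ (g : ℤ) - d + r := by
    by_contra! hlt
    nlinarith
  have hn : (d : ℤ) < 2 * g - 1 := by nlinarith
  have hbound := lattice_path_bound (n := 2 * (g : ℤ) - 1) (d₀ := d - R 0) (g := g) (r := r)
    (P := ChipBound g D R) hRg hR (by omega)
    ⟨0, fun _ => le_rfl, by simp, fun hi F _ hDF => by
      rw [tailDeg_zero, ← hDF.sum_eq, hdeg]; simp⟩
    (fun i hi j c h => h.remove hi) (fun i hi j c h => h.step hg hR hi)
    (fun i hi j hj c h => h.nonneg hg hRg hR hrank hi hj)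
  nlinarith
end
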